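/- For every n ≥ 3, there is no n-ary operation t on {0,1,2} that preserves both C_3 and R^⇒_2 and satisfies the quasi near-unanimity condition QNU(n). -/

import Mathlib

/-- The three-element domain `{0,1,2}`. -/
abbrev D3 : Type := Fin 3

/-- `n`-ary operations on `{0,1,2}`. -/
abbrev Op (n : ℕ) : Type := (Fin n → D3) → D3

/-- An `n`-ary operation `f` preserves a `k`-ary relation `R`. -/
def Preserves {n k : ℕ} (f : Op n) (R : Set (Fin k → D3)) : Prop :=
  ∀ t : Fin n → (Fin k → D3), (∀ i, t i ∈ R) → (fun j => f fun i => t i j) ∈ R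

/-- `C₃ = {(0,1),(1,2),(2,0)}`. -/
def C3rel : Set (Fin 2 → D3) :=
  { t | (t 0 = 0 ∧ t 1 = 1) ∨ (t 0 = 1 ∧ t 1 = 2) ∨ (t 0 = 2 ∧ t 1 = 0) }

/-- `R⇒₂ = {(x,y,z) : x,y ∈ {0,1} ∧ (x = y = 0 → z = 0)}`. -/
def Rimp2rel : Set (Fin 3 → D3) :=
  { t | (t 0 = 0 ∨ t 0 = 1) ∧ (t 1 = 0 ∨ t 1 = 1) ∧ (t 0 = 0 → t 1 = 0 → t 2 = 0) }

/-- The quasi near-unanimity condition `QNU(n)`: every evaluation with one argument `y` and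
all other arguments `x` equals `t(x,…,x)`. -/
def QNU {n : ℕ} (t : Op n) : Prop :=
  ∀ x y : D3, ∀ j : Fin n, t (fun i => if i = j then y else x) = t fun _ => x

/-- For every `n ≥ 3` there is no `n`-ary operation preserving `C₃` and `R⇒₂` that
satisfies `QNU(n)`. -/
theorem stmt17 :
    ∀ n : ℕ, 3 ≤ n →
      ¬ ∃ t : Op n, Preserves t C3rel ∧ Preserves t Rimp2rel ∧ QNU t := by
  rintro n - ⟨t, hC, hR, hQ⟩
  have h01 := hC (fun _ => ![0, 1]) (fun i => Or.inl ⟨rfl, rfl⟩)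
  have h12 := hC (fun _ => ![1, 2]) (fun i => Or.inr (Or.inl ⟨rfl, rfl⟩))
  have hr := hR (fun _ => ![0, 1, 0]) (fun i => ⟨Or.inl rfl, Or.inr rfl, fun _ _ => rfl⟩)
  simp [C3rel] at h01 h12
  simp [Rimp2rel] at hr
  have h0 : t (fun _ => 0) = 0 := by
    generalize t (fun _ => 0) = a at *
    generalize t (fun _ => 1) = b at *
    rcases hr with ⟨h1 | h1, h2 | h2, -⟩ <;> subst h1 <;> subst h2 <;> simp_all
  have h1 : t (fun _ => 1) ≠ 0 := by
    intro h
    rw [h0, h] at h01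
    simp at h01
  have key : ∀ s : Finset (Fin n), t (fun i => if i ∈ s then 1 else 0) = 0 := by
    intro s
    induction s using Finset.induction_on with
    | empty => simpa using h0
    | insert j s hj ih =>
      have h := hR (fun i => ![if i ∈ s then 1 else 0, if i = j then 1 else 0,
        if i ∈ insert j s then 1 else 0]) (by
          intro i
          by_cases a : i ∈ s <;> by_cases b : i = j <;> simp [Rimp2rel, a, b, hj])
      exact h.2.2 ih ((hQ 0 1 j).trans h0)
  exact h1 (by simpa using key Finset.univ)
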